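/- Let G be a profinite group and U a pseudocompact k⟦G⟧-module, with inverse system {U_N, φ_{MN}} of coinvariant modules over open normal subgroups N of G. The restriction of this inverse system to the socles Soc(U_N) is again an inverse system (i.e., φ_{MN}(Soc(U_N)) ⊆ Soc(U_M) whenever N ≤ M), and its inverse limit is the maximal closed semisimple submodule of U. -/

import Mathlib

open scoped Classical
set_option maxHeartbeats 1000000
set_option synthInstance.maxHeartbeats 400000

noncomputable section

namespace ProfiniteBlocks

variable (k : Type) [Field k] (G : Type) [Group G] [TopologicalSpace G]

/-- Discrete topology on each finite level group algebra. -/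
instance (X : Type) : TopologicalSpace (MonoidAlgebra k X) := ⊥

/-- The canonical quotient homomorphism `G/N → G/M` for `N ≤ M`. -/
def qHom (N M : OpenNormalSubgroup G) (h : N ≤ M) :
    G ⧸ N.toSubgroup →* G ⧸ M.toSubgroup :=
  QuotientGroup.map _ _ (MonoidHom.id G) (fun x hx => h hx)

/-- The induced algebra homomorphism `k[G/N] → k[G/M]` for `N ≤ M`. -/
def tHom (N M : OpenNormalSubgroup G) (h : N ≤ M) :
    MonoidAlgebra k (G ⧸ N.toSubgroup) →ₐ[k] MonoidAlgebra k (G ⧸ M.toSubgroup) :=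
  MonoidAlgebra.mapDomainAlgHom k k (qHom G N M h)

/-- The completed group algebra `k⟦G⟧`, realized as the inverse limit of the finite
level group algebras `k[G/N]` over all open normal subgroups `N` of `G`, sitting inside
their product. -/
def CGA : Subalgebra k (∀ N : OpenNormalSubgroup G, MonoidAlgebra k (G ⧸ N.toSubgroup)) where
  carrier := {x | ∀ (N M : OpenNormalSubgroup G) (h : N ≤ M), tHom k G N M h (x N) = x M}
  add_mem' hx hy N M h := by simp [map_add, hx N M h, hy N M h]
  mul_mem' hx hy N M h := by simp [map_mul, hx N M h, hy N M h]
  algebraMap_mem' r N M h := by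
    simp [tHom, MonoidAlgebra.mapDomainAlgHom, MonoidAlgebra.mapDomainRingHom,
      Finsupp.mapDomain_single]

instance : Ring (CGA k G) := inferInstance
instance : Algebra k (CGA k G) := inferInstance

/-- `k⟦G⟧` carries the inverse limit topology (each `k[G/N]` being discrete). -/
instance : TopologicalSpace (CGA k G) := inferInstanceAs (TopologicalSpace (Subtype _))

/-- The canonical (continuous) inclusion of `G` into `k⟦G⟧`. -/
def ofG : G →* CGA k G where
  toFun g := ⟨fun N => MonoidAlgebra.single ((g : G) : G ⧸ N.toSubgroup) 1, by
    intro N M h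
    simp [tHom, MonoidAlgebra.mapDomainAlgHom, MonoidAlgebra.mapDomainRingHom,
      Finsupp.mapDomain_single, qHom, QuotientGroup.map_mk]
    rfl⟩
  map_one' := by
    ext N
    simp [MonoidAlgebra.one_def]
  map_mul' g g' := by
    ext N
    simp [MonoidAlgebra.single_mul_single]


/-- The map between quotient modules induced by `f` (the canonical map whenever
`f` carries `P` into `Q`). -/
def mapQ' {R X Y : Type} [Ring R] [AddCommGroup X] [AddCommGroup Y] [Module R X]
    [Module R Y] (P : Submodule R X) (Q : Submodule R Y) (f : X →ₗ[R] Y) :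
    (X ⧸ P) →ₗ[R] (Y ⧸ Q) :=
  if h : P ≤ Q.comap f then Submodule.mapQ P Q f h else 0

/-- The map between submodules induced by `f` (the canonical restriction whenever
`f` carries `P` into `Q`). -/
def restrict' {R X Y : Type} [Ring R] [AddCommGroup X] [AddCommGroup Y] [Module R X]
    [Module R Y] (P : Submodule R X) (Q : Submodule R Y) (f : X →ₗ[R] Y) :
    P →ₗ[R] Q :=
  if h : ∀ x ∈ P, f x ∈ Q then f.restrict h else 0

/-- The subquotient `W / W'` of a module. -/
abbrev subQuot {R X : Type} [Ring R] [AddCommGroup X] [Module R X]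
    (W W' : Submodule R X) : Type :=
  W ⧸ (W'.comap W.subtype)

/-- The radical of a topological module: the intersection of its maximal open
submodules. -/
def radical (R : Type) [Ring R] (X : Type) [AddCommGroup X] [Module R X]
    [TopologicalSpace X] : Submodule R X :=
  sInf {W : Submodule R X | IsCoatom W ∧ IsOpen (W : Set X)}

/-- Iterated radicals `Rad^i(X)`, with `Rad^0(X) = X`. -/
def radPow (R : Type) [Ring R] (X : Type) [AddCommGroup X] [Module R X]
    [TopologicalSpace X] : ℕ → Submodule R X
  | 0 => ⊤
  | (n + 1) => (radical R (radPow R X n)).map (radPow R X n).subtype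

/-- A topological module is semisimple if every closed submodule has a closed
complement. -/
def IsSemisimpleTop (R : Type) [Ring R] (X : Type) [AddCommGroup X] [Module R X]
    [TopologicalSpace X] : Prop :=
  ∀ W : Submodule R X, IsClosed (W : Set X) →
    ∃ W' : Submodule R X, IsClosed (W' : Set X) ∧ IsCompl W W'

/-- The socle of a topological module: the largest closed semisimple submodule
(defined as the join of all closed semisimple submodules). -/
def socle (R : Type) [Ring R] (X : Type) [AddCommGroup X] [Module R X]
    [TopologicalSpace X] : Submodule R X :=
  sSup {W : Submodule R X | IsClosed (W : Set X) ∧ IsSemisimpleTop R W}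

/-- A module is uniserial if its submodules form a chain. -/
def Uniserial (R : Type) [Ring R] (X : Type) [AddCommGroup X] [Module R X] : Prop :=
  ∀ W W' : Submodule R X, W ≤ W' ∨ W' ≤ W

/-- A topological module is (topologically) indecomposable if it is non-zero and
admits no non-trivial decomposition into closed direct summands. -/
def IsIndecTop (R : Type) [Ring R] (X : Type) [AddCommGroup X] [Module R X]
    [TopologicalSpace X] : Prop :=
  Nontrivial X ∧ ∀ W W' : Submodule R X, IsClosed (W : Set X) → IsClosed (W' : Set X) →
    IsCompl W W' → W = ⊥ ∨ W' = ⊥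

/-- The inverse limit of a compatible system of modules indexed by a preorder,
realized as the submodule of compatible families in the product. -/
def compatLim {ι : Type} [Preorder ι] {R : Type} [Ring R] (T : ι → Type)
    [∀ i, AddCommGroup (T i)] [∀ i, Module R (T i)]
    (t : ∀ i j, i ≤ j → (T i →ₗ[R] T j)) : Submodule R (∀ i, T i) where
  carrier := {f | ∀ (i j : ι) (h : i ≤ j), t i j h (f i) = f j}
  add_mem' ha hb i j h := by simp only [Pi.add_apply, map_add]; rw [ha i j h, hb i j h]
  zero_mem' i j h := by simp
  smul_mem' c a ha i j h := by simp only [Pi.smul_apply, map_smul]; rw [ha i j h]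

/-- `X` has exactly `n` composition factors (measured along the radical series). -/
def HasNFactors (R : Type) [Ring R] (X : Type) [AddCommGroup X] [Module R X]
    [TopologicalSpace X] (n : ℕ) : Prop :=
  radPow R X n = ⊥ ∧ ∀ m < n, radPow R X m ≠ ⊥

/-- `X` has infinitely many composition factors. -/
def HasInfFactors (R : Type) [Ring R] (X : Type) [AddCommGroup X] [Module R X]
    [TopologicalSpace X] : Prop :=
  ∀ n : ℕ, radPow R X n ≠ ⊥



section Coinvariants

variable {k : Type} [Field k] {G : Type} [Group G] [TopologicalSpace G]

variable (k G) in
/-- The (closed) submodule `I_N U` of a topological `k⟦G⟧`-module `U`: the smallest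
closed submodule containing all elements `n • u - u` for `n ∈ N`.  Its quotient is the
module of `N`-coinvariants. -/
def coinvKer (N : OpenNormalSubgroup G) (U : Type) [AddCommGroup U]
    [Module (CGA k G) U] [TopologicalSpace U] : Submodule (CGA k G) U :=
  sInf {W : Submodule (CGA k G) U | IsClosed (W : Set U) ∧
    ∀ n ∈ N.toSubgroup, ∀ u : U, ofG k G n • u - u ∈ W}

variable (k G) in
/-- The module of `N`-coinvariants `U_N` of a topological `k⟦G⟧`-module `U`. -/
abbrev coinv (N : OpenNormalSubgroup G) (U : Type) [AddCommGroup U]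
    [Module (CGA k G) U] [TopologicalSpace U] : Type :=
  U ⧸ coinvKer k G N U

variable (k G) in
/-- The canonical projection `φ_N : U → U_N`. -/
def phi (N : OpenNormalSubgroup G) (U : Type) [AddCommGroup U]
    [Module (CGA k G) U] [TopologicalSpace U] : U →ₗ[CGA k G] coinv k G N U :=
  (coinvKer k G N U).mkQ

lemma coinvKer_mono {N M : OpenNormalSubgroup G} (h : N ≤ M) (U : Type) [AddCommGroup U]
    [Module (CGA k G) U] [TopologicalSpace U] : coinvKer k G N U ≤ coinvKer k G M U :=
  sInf_le_sInf (fun W hW => ⟨hW.1, fun n hn u => hW.2 n (h hn) u⟩)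

variable (k G) in
/-- The canonical projection `φ_{MN} : U_N → U_M` for `N ≤ M`. -/
def phiT (N M : OpenNormalSubgroup G) (h : N ≤ M) (U : Type) [AddCommGroup U]
    [Module (CGA k G) U] [TopologicalSpace U] :
    coinv k G N U →ₗ[CGA k G] coinv k G M U :=
  Submodule.mapQ _ _ LinearMap.id (fun _ hx => coinvKer_mono h U hx)

variable (k G) in
/-- `N` acts trivially on the `k⟦G⟧`-module `W`. -/
def NTrivial (N : OpenNormalSubgroup G) (W : Type) [AddCommGroup W]
    [Module (CGA k G) W] : Prop :=
  ∀ n ∈ N.toSubgroup, ∀ w : W, ofG k G n • w = w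

end Coinvariants

section Pseudocompact

variable (k : Type) [Field k]

/-- A pseudocompact module over a topological `k`-algebra `A`: a Hausdorff topological
module possessing a basis of neighbourhoods of `0` consisting of open submodules of
finite codimension which intersect in `0`, and which is the inverse limit of the
corresponding discrete quotients. -/
structure IsPseudocompactMod (A : Type) [Ring A] [Algebra k A] [TopologicalSpace A]
    (X : Type) [AddCommGroup X] [Module k X] [Module A X] [IsScalarTower k A X]
    [TopologicalSpace X] : Prop where
  t2 : T2Space X
  addGroup : IsTopologicalAddGroup X
  contSMul : ContinuousSMul A X
  basis : (nhds (0 : X)).HasBasis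
    (fun V : Submodule A X => IsOpen (V : Set X) ∧
      FiniteDimensional k (X ⧸ V.restrictScalars k))
    (fun V => (V : Set X))
  inf_bot : (⨅ (V : Submodule A X) (_ : IsOpen (V : Set X) ∧
      FiniteDimensional k (X ⧸ V.restrictScalars k)), V) = ⊥
  complete : ∀ c : ∀ V : {V : Submodule A X // IsOpen (V : Set X) ∧
      FiniteDimensional k (X ⧸ V.restrictScalars k)}, X ⧸ V.1,
    (∀ (V W : {V : Submodule A X // IsOpen (V : Set X) ∧
        FiniteDimensional k (X ⧸ V.restrictScalars k)}), V.1 ≤ W.1 →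
      mapQ' V.1 W.1 LinearMap.id (c V) = c W) →
    ∃ x : X, ∀ V, c V = Submodule.Quotient.mk x

end Pseudocompact

section Blocks

variable (R : Type) [Ring R]

/-- A block idempotent: a centrally primitive idempotent of `R`. -/
structure IsBlockIdem (e : R) : Prop where
  idem : IsIdempotentElem e
  ne_zero : e ≠ 0
  central : e ∈ Set.center R
  primitive : ∀ f g : R, f ∈ Set.center R → g ∈ Set.center R → IsIdempotentElem f →
    IsIdempotentElem g → f * g = 0 → g * f = 0 → e = f + g → f = 0 ∨ g = 0

/-- The block `B = Re` determined by a central idempotent `e`, as a left `R`-module. -/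
def blockMod (e : R) (he : e ∈ Set.center R) : Submodule R R where
  carrier := {a : R | a * e = a}
  add_mem' := by intro a b ha hb; simp only [Set.mem_setOf_eq, add_mul] at *; rw [ha, hb]
  zero_mem' := by simp
  smul_mem' := by
    intro c a ha
    simp only [Set.mem_setOf_eq, smul_eq_mul, mul_assoc] at *
    rw [ha]

/-- A module belongs to the block of the central idempotent `e` if `e` acts as the
identity on it. -/
def InBlock {X : Type} [AddCommGroup X] [Module R X] (e : R) : Prop :=
  ∀ x : X, e • x = x

end Blocks

section Defect

variable {k : Type} [Field k] {G : Type} [Group G] [TopologicalSpace G]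

variable (k G) in
/-- The conjugation action of `G` on `k⟦G⟧`. -/
def conjAct (g : G) (x : CGA k G) : CGA k G :=
  ofG k G g * x * ofG k G g⁻¹

variable (k G) in
/-- The `H`-fixed points of `k⟦G⟧` under conjugation. -/
def fixedBy (H : Subgroup G) : Set (CGA k G) :=
  {x : CGA k G | ∀ h ∈ H, conjAct k G h x = x}

variable (k G) in
/-- The relative trace map `Tr_H^G` on `k⟦G⟧` (a finite sum over coset
representatives when `H` is open). -/
def trMap (H : Subgroup G) (x : CGA k G) : CGA k G :=
  ∑ᶠ c : G ⧸ H, conjAct k G (Quotient.out c) x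

variable (k G) in
/-- The image `Tr_H^G(k⟦G⟧^H)`. -/
def trImage (H : Subgroup G) : Set (CGA k G) :=
  trMap k G H '' fixedBy k G H

variable (k G) in
/-- `D` satisfies the defect property for `e`:
`e ∈ ⋂_N Tr_{DN}^G (k⟦G⟧^{DN})`. -/
def DefectProp (e : CGA k G) (D : Subgroup G) : Prop :=
  ∀ N : OpenNormalSubgroup G, e ∈ trImage k G (D ⊔ N.toSubgroup)

variable (k G) in
/-- `D` is a defect group of the block of `e`: a closed subgroup, minimal subject to
the defect property. -/
structure IsDefectGroup (e : CGA k G) (D : Subgroup G) : Prop where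
  closed : IsClosed (D : Set G)
  defect : DefectProp k G e D
  minimal : ∀ D' : Subgroup G, IsClosed ((D' : Set G)) → D' ≤ D →
    DefectProp k G e D' → D' = D

end Defect

section FiniteDefect

variable (k : Type) [Field k] (Q : Type) [Group Q]

/-- Conjugation on a finite level group algebra `k[Q]`. -/
def conjActF (q : Q) (x : MonoidAlgebra k Q) : MonoidAlgebra k Q :=
  MonoidAlgebra.single q 1 * x * MonoidAlgebra.single q⁻¹ 1

/-- `H`-fixed points of `k[Q]` under conjugation. -/
def fixedByF (H : Subgroup Q) : Set (MonoidAlgebra k Q) :=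
  {x | ∀ h ∈ H, conjActF k Q h x = x}

/-- The relative trace map `Tr_H^Q` on `k[Q]`. -/
def trMapF (H : Subgroup Q) (x : MonoidAlgebra k Q) : MonoidAlgebra k Q :=
  ∑ᶠ c : Q ⧸ H, conjActF k Q (Quotient.out c) x

/-- The image `Tr_H^Q(k[Q]^H)`. -/
def trImageF (H : Subgroup Q) : Set (MonoidAlgebra k Q) :=
  trMapF k Q H '' fixedByF k Q H

/-- `Dq` is a defect group of the block of `e` in the group algebra `k[Q]`. -/
structure IsDefectGroupF (e : MonoidAlgebra k Q) (Dq : Subgroup Q) : Prop where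
  defect : e ∈ trImageF k Q Dq
  minimal : ∀ D' : Subgroup Q, D' ≤ Dq → e ∈ trImageF k Q D' → D' = Dq

end FiniteDefect

section CyclicDefect

variable {k : Type} [Field k] {G : Type} [Group G] [TopologicalSpace G]

variable (G) in
/-- A subgroup is procyclic if it possesses a dense cyclic (abstract) subgroup. -/
def IsProcyclic (D : Subgroup G) : Prop :=
  ∃ g : G, closure ((Subgroup.zpowers g : Subgroup G) : Set G) = (D : Set G)

variable (G) in
/-- `D` is isomorphic, as a topological group, to the `p`-adic integers `ℤ_p`. -/
def IsZpGroup (p : ℕ) [Fact p.Prime] (D : Subgroup G) : Prop :=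
  ∃ φ : D ≃ₜ Multiplicative ℤ_[p], ∀ x y : D, φ (x * y) = φ x * φ y

variable (G) in
/-- `D` is a cyclic pro-`p` group: either a finite cyclic `p`-group or `ℤ_p`. -/
def IsCyclicProP (p : ℕ) [Fact p.Prime] (D : Subgroup G) : Prop :=
  (Finite D ∧ IsPGroup p D ∧ IsCyclic D) ∨ IsZpGroup G p D

end CyclicDefect

section Simples

variable {k : Type} [Field k] {G : Type} [Group G] [TopologicalSpace G]

variable (k G) in
/-- The projection `k⟦G⟧ → k[G/N]`. -/
def projN (N : OpenNormalSubgroup G) (x : CGA k G) :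
    MonoidAlgebra k (G ⧸ N.toSubgroup) :=
  (x : ∀ N : OpenNormalSubgroup G, MonoidAlgebra k (G ⧸ N.toSubgroup)) N

variable (k G) in
/-- `N` acts trivially on every simple module of the block of `e`. -/
def TrivOnSimples (e : CGA k G) (N : OpenNormalSubgroup G) : Prop :=
  ∀ (S : Type) [AddCommGroup S] [Module (CGA k G) S],
    IsSimpleModule (CGA k G) S → InBlock (CGA k G) (X := S) e → NTrivial k G N S

variable (k G) in
/-- Membership of `N` in the standard cofinal system `𝒩` for the block `B` of `e`
with defect group `D`: the coinvariant algebra `B_N` is a block of `k[G/N]` with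
defect group `DN/N`, and `N` acts trivially on every simple `B`-module. -/
structure GoodN (e : CGA k G) (D : Subgroup G) (N : OpenNormalSubgroup G) : Prop where
  blockN : IsBlockIdem (MonoidAlgebra k (G ⧸ N.toSubgroup)) (projN k G N e)
  defectN : IsDefectGroupF k (G ⧸ N.toSubgroup) (projN k G N e)
    (D.map (QuotientGroup.mk' N.toSubgroup))
  triv : TrivOnSimples k G e N

/-- A cofinal set of open normal subgroups. -/
def IsCofinal {G : Type} [Group G] [TopologicalSpace G]
    (𝒩 : Set (OpenNormalSubgroup G)) : Prop :=
  ∀ M : OpenNormalSubgroup G, ∃ N ∈ 𝒩, N ≤ M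

variable (k G) in
/-- A pseudocompact module is pro-uniserial (w.r.t. the cofinal system `𝒩`) if all
its coinvariant quotients at members of `𝒩` are uniserial. -/
def ProUniserial (𝒩 : Set (OpenNormalSubgroup G)) (U : Type) [AddCommGroup U]
    [Module (CGA k G) U] [TopologicalSpace U] : Prop :=
  ∀ N ∈ 𝒩, Uniserial (CGA k G) (coinv k G N U)

variable (k G) in
/-- `S` is a composition factor of the pseudocompact module `U`: it is a composition
factor of some finite coinvariant quotient `U_N`. -/
def IsCompFactorOf (U : Type) [AddCommGroup U] [Module (CGA k G) U]
    [TopologicalSpace U] (S : Type) [AddCommGroup S] [Module (CGA k G) S] : Prop :=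
  ∃ (N : OpenNormalSubgroup G) (W W' : Submodule (CGA k G) (coinv k G N U)),
    W' ≤ W ∧ Nonempty (subQuot W W' ≃ₗ[CGA k G] S)

variable (k G) in
/-- `S` is a composition factor of the finite-dimensional module `X`. -/
def IsCompFactorFin (X : Type) [AddCommGroup X] [Module (CGA k G) X]
    (S : Type) [AddCommGroup S] [Module (CGA k G) S] : Prop :=
  ∃ W W' : Submodule (CGA k G) X, W' ≤ W ∧ Nonempty (subQuot W W' ≃ₗ[CGA k G] S)

end Simples

section Projective

variable {k : Type} [Field k] {G : Type} [Group G] [TopologicalSpace G]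

variable (k G) in
/-- A pseudocompact `k⟦G⟧`-module is (categorically) projective if every continuous
surjection onto it from a pseudocompact module splits. -/
def IsPCProjective (P : Type) [AddCommGroup P] [Module (CGA k G) P]
    [TopologicalSpace P] : Prop :=
  ∀ (W : Type) [AddCommGroup W] [Module k W] [Module (CGA k G) W]
    [IsScalarTower k (CGA k G) W] [TopologicalSpace W],
    IsPseudocompactMod k (CGA k G) W →
    ∀ f : W →ₗ[CGA k G] P, Continuous f → Function.Surjective f →
      ∃ s : P →ₗ[CGA k G] W, Continuous s ∧ f.comp s = LinearMap.id

variable (k G) in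
/-- `P` is a projective cover of the simple module `S` in the block of `e`:
a pseudocompact projective module of the block together with a surjection onto `S`
whose kernel is superfluous (contained in the radical). -/
structure IsProjCover (e : CGA k G) (P : Type) [AddCommGroup P] [Module k P]
    [Module (CGA k G) P] [IsScalarTower k (CGA k G) P] [TopologicalSpace P]
    (S : Type) [AddCommGroup S] [Module (CGA k G) S] : Prop where
  pseudocompact : IsPseudocompactMod k (CGA k G) P
  inBlock : InBlock (CGA k G) (X := P) e
  projective : IsPCProjective k G P
  cover : ∃ π : P →ₗ[CGA k G] S, Function.Surjective π ∧
    LinearMap.ker π ≤ radical (CGA k G) P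

end Projective




/-- The map between subquotients induced by `f`. -/
def subQuotMap {R X Y : Type} [Ring R] [AddCommGroup X] [AddCommGroup Y] [Module R X]
    [Module R Y] (W W' : Submodule R X) (V V' : Submodule R Y) (f : X →ₗ[R] Y) :
    subQuot W W' →ₗ[R] subQuot V V' :=
  mapQ' (W'.comap W.subtype) (V'.comap V.subtype) (restrict' W V f)

/-- The conditions of Proposition 3.8 on a pair of pro-uniserial submodules `X`, `Y`
of an indecomposable projective `P`: `X ∩ Y = Soc(P)`, `X + Y = Rad(P)`, and
`Rad(P)/Soc(P) ≅ X/Soc(P) ⊕ Y/Soc(P)` with no common composition factors. -/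
def ProUniserialPair (k : Type) [Field k] (G : Type) [Group G] [TopologicalSpace G]
    (𝒩 : Set (OpenNormalSubgroup G)) (P : Type) [AddCommGroup P]
    [Module (CGA k G) P] [TopologicalSpace P]
    (X Y : Submodule (CGA k G) P) : Prop :=
  ProUniserial k G 𝒩 X ∧ ProUniserial k G 𝒩 Y ∧
  X ⊓ Y = socle (CGA k G) P ∧
  X ⊔ Y = radical (CGA k G) P ∧
  Nonempty ((subQuot (radical (CGA k G) P) (socle (CGA k G) P)) ≃ₗ[CGA k G]
    (subQuot X (socle (CGA k G) P) × subQuot Y (socle (CGA k G) P))) ∧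
  ∀ (T : Type) [AddCommGroup T] [Module (CGA k G) T], IsSimpleModule (CGA k G) T →
    ¬ (IsCompFactorOf k G (subQuot X (socle (CGA k G) P)) T ∧
       IsCompFactorOf k G (subQuot Y (socle (CGA k G) P)) T)

/-- `S : ι → Type` is a complete set of pairwise non-isomorphic representatives of
the simple modules of the block of `e`. -/
def IsSimpleReps (k : Type) [Field k] (G : Type) [Group G] [TopologicalSpace G]
    (e : CGA k G) {ι : Type} (S : ι → Type) [∀ i, AddCommGroup (S i)]
    [∀ i, Module (CGA k G) (S i)] : Prop :=
  (∀ i, IsSimpleModule (CGA k G) (S i) ∧ InBlock (CGA k G) (X := S i) e) ∧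
  (∀ i j, i ≠ j → IsEmpty (S i ≃ₗ[CGA k G] S j)) ∧
  (∀ (T : Type) [AddCommGroup T] [Module (CGA k G) T],
    IsSimpleModule (CGA k G) T → InBlock (CGA k G) (X := T) e →
      ∃ i, Nonempty (T ≃ₗ[CGA k G] S i))

section Brauer

/-- The size of the `ρ`-orbit of `i` (the number of edges at the corresponding vertex
of the Brauer tree). -/
def orbSize {ι : Type} (ρ : Equiv.Perm ι) (i : ι) : ℕ :=
  Function.minimalPeriod ρ i

/-- Data describing the exceptional vertex of a Brauer tree: `none` if there is no
exceptional vertex, and otherwise a flag recording whether it is a `ρ`-vertex or a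
`σ`-vertex together with an edge adjacent to it. -/
abbrev ExcVertex (ι : Type) : Type := Option (Bool × ι)

/-- The edge `i` is adjacent to the exceptional vertex, its `ρ`-endpoint being
exceptional. -/
def AdjExcRho {ι : Type} (ρ : Equiv.Perm ι) (exc : ExcVertex ι) (i : ι) : Prop :=
  ∃ j : ι, exc = some (true, j) ∧ ρ.SameCycle j i

/-- The edge `i` is adjacent to the exceptional vertex, its `σ`-endpoint being
exceptional. -/
def AdjExcSigma {ι : Type} (σ : Equiv.Perm ι) (exc : ExcVertex ι) (i : ι) : Prop :=
  ∃ j : ι, exc = some (false, j) ∧ σ.SameCycle j i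

/-- The edge `i` is adjacent to the exceptional vertex. -/
def AdjExc {ι : Type} (ρ σ : Equiv.Perm ι) (exc : ExcVertex ι) (i : ι) : Prop :=
  AdjExcRho ρ exc i ∨ AdjExcSigma σ exc i

end Brauer


section AlgebraicSocle

variable {R X Y : Type} [Ring R] [AddCommGroup X] [Module R X] [AddCommGroup Y] [Module R Y]

variable (R X) in
/-- The largest (abstractly) semisimple submodule of a module. -/
def algSocle : Submodule R X :=
  ⨆ W ∈ {W : Submodule R X | IsSemisimpleModule R W}, W

lemma isSemisimpleModule_algSocle : IsSemisimpleModule R (algSocle R X) :=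
  isSemisimpleModule_biSup_of_isSemisimpleModule_submodule (p := id) fun _ h => h

lemma le_algSocle {W : Submodule R X} (h : IsSemisimpleModule R W) : W ≤ algSocle R X :=
  le_biSup (fun W : Submodule R X => W) h

lemma comap_algSocle {f : X →ₗ[R] Y} (hf : Function.Injective f) :
    (algSocle R Y).comap f = algSocle R X := by
  apply le_antisymm
  · have := isSemisimpleModule_algSocle (R := R) (X := Y)
    exact le_algSocle (IsSemisimpleModule.of_injective
      (f.restrict (p := (algSocle R Y).comap f) (q := algSocle R Y) fun _ h => h)
      fun a b h => Subtype.ext (hf (congrArg Subtype.val h)))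
  · rw [← Submodule.map_le_iff_le_comap]
    have := isSemisimpleModule_algSocle (R := R) (X := X)
    refine le_algSocle (IsSemisimpleModule.congr
      (Submodule.equivMapOfInjective f hf (algSocle R X)).symm)

lemma mk_mem_algSocle_comap_iff (f : X →ₗ[R] Y) (V : Submodule R Y) (x : X) :
    (V.comap f).mkQ x ∈ algSocle R (X ⧸ V.comap f) ↔ V.mkQ (f x) ∈ algSocle R (Y ⧸ V) := by
  have hinj : Function.Injective ((V.comap f).mapQ V f le_rfl) := by
    rw [← LinearMap.ker_eq_bot, Submodule.ker_mapQ, Submodule.mkQ_map_self]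
  rw [← comap_algSocle hinj]
  rfl

lemma exists_complement_of_isSemisimpleModule_quotient (V K : Submodule R X)
    [IsSemisimpleModule R (X ⧸ V)] : ∃ C, V ≤ C ∧ C ⊓ K ≤ V ∧ K ⊔ C = ⊤ := by
  obtain ⟨C, hC⟩ := exists_isCompl (K.map V.mkQ)
  refine ⟨C.comap V.mkQ, V.le_comap_mkQ C, fun x hx => ?_, ?_⟩
  · have : V.mkQ x ∈ (⊥ : Submodule R (X ⧸ V)) :=
      hC.inf_eq_bot ▸ ⟨Submodule.mem_map_of_mem hx.2, hx.1⟩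
    exact (Submodule.Quotient.mk_eq_zero V).1 ((Submodule.mem_bot R).1 this)
  · rw [eq_top_iff]
    rintro x -
    obtain ⟨_, ⟨y, hy, rfl⟩, c, hc, hyc⟩ := Submodule.mem_sup.1
      (hC.sup_eq_top ▸ Submodule.mem_top : V.mkQ x ∈ K.map V.mkQ ⊔ C)
    refine Submodule.mem_sup.2 ⟨y, hy, x - y, ?_, add_sub_cancel _ _⟩
    rwa [Submodule.mem_comap, map_sub, ← hyc, add_sub_cancel_left]

end AlgebraicSocle

section LinearlyCompact

variable {R X Y : Type} [Ring R] [AddCommGroup X] [Module R X] [TopologicalSpace X]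
  [AddCommGroup Y] [Module R Y] [TopologicalSpace Y]

variable (R X) in
/-- A topological module is linearly compact if every family of cosets of closed submodules
with the finite intersection property has a common point. -/
def LinearlyCompact : Prop :=
  ∀ (ι : Type) (x : ι → X) (W : ι → Submodule R X), (∀ i, IsClosed (W i : Set X)) →
    (∀ s : Finset ι, ∃ y, ∀ i ∈ s, y - x i ∈ W i) → ∃ y, ∀ i, y - x i ∈ W i

lemma LinearlyCompact.submodule (hX : LinearlyCompact R X) {S : Submodule R X}
    (hS : IsClosed (S : Set X)) : LinearlyCompact R S := by
  intro ι x W hW hfin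
  rcases isEmpty_or_nonempty ι with hι | ⟨⟨i₀⟩⟩
  · exact ⟨0, fun i => isEmptyElim i⟩
  obtain ⟨y, hy⟩ := hX ι (fun i => (x i : X)) (fun i => (W i).map S.subtype)
    (fun i => hS.isClosedEmbedding_subtypeVal.isClosedMap _ (hW i))
    (fun s => by
      obtain ⟨y, hy⟩ := hfin s
      exact ⟨y, fun i hi => ⟨y - x i, hy i hi, rfl⟩⟩)
  have hyS : y ∈ S := by
    obtain ⟨w, -, hw⟩ := hy i₀
    have : y = w + x i₀ := eq_add_of_sub_eq hw.symm
    exact this ▸ S.add_mem w.2 (x i₀).2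
  refine ⟨⟨y, hyS⟩, fun i => ?_⟩
  obtain ⟨w, hw, hwy⟩ := hy i
  rwa [← show w = ⟨y, hyS⟩ - x i from Subtype.ext hwy]

lemma LinearlyCompact.of_surjective (hX : LinearlyCompact R X) (f : X →ₗ[R] Y)
    (hf : Continuous f) (hs : Function.Surjective f) : LinearlyCompact R Y := by
  intro ι x W hW hfin
  choose g hg using hs
  obtain ⟨y, hy⟩ := hX ι (fun i => g (x i)) (fun i => (W i).comap f)
    (fun i => (hW i).preimage hf)
    (fun s => by
      obtain ⟨y, hy⟩ := hfin s
      exact ⟨g y, fun i hi => by simpa [hg] using hy i hi⟩)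
  exact ⟨f y, fun i => by simpa [hg] using hy i⟩

/-- A complete linearly topologized module whose discrete quotients are Artinian is linearly
compact. -/
theorem linearlyCompact_of_complete [IsTopologicalAddGroup X]
    (hart : ∀ V : Submodule R X, IsOpen (V : Set X) → IsArtinian R (X ⧸ V))
    (hbasis : (nhds (0 : X)).HasBasis (fun V : Submodule R X => IsOpen (V : Set X))
      (fun V => (V : Set X)))
    (hcomplete : ∀ x : {V : Submodule R X // IsOpen (V : Set X)} → X,
      (∀ V W, V.1 ≤ W.1 → x V - x W ∈ W.1) → ∃ y, ∀ V, y - x V ∈ V.1) :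
    LinearlyCompact R X := by
  intro ι x₀ W₀ hW₀ hfin₀
  let 𝒵 : Set (Set (X × Submodule R X)) := {F | (∀ c ∈ F, IsClosed (c.2 : Set X)) ∧
    ∀ s : Finset (X × Submodule R X), ↑s ⊆ F → ∃ y, ∀ c ∈ s, y - c.1 ∈ c.2}
  have h₀ : Set.range (fun i => (x₀ i, W₀ i)) ∈ 𝒵 := by
    refine ⟨by rintro _ ⟨i, rfl⟩; exact hW₀ i, fun s hs => ?_⟩
    choose g hg using hs
    obtain ⟨y, hy⟩ := hfin₀ (s.attach.image fun c => g c.2)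
    refine ⟨y, fun c hc => ?_⟩
    have := hy (g hc) (Finset.mem_image.2 ⟨⟨c, hc⟩, Finset.mem_attach _ _, rfl⟩)
    rwa [← show (x₀ (g hc), W₀ (g hc)) = c from hg hc]
  obtain ⟨F, hF₀, hFmax⟩ := zorn_subset_nonempty 𝒵 (fun 𝒞 h𝒞 hchain hne =>
    ⟨⋃₀ 𝒞, ⟨fun c ⟨F, hF, hc⟩ => (h𝒞 hF).1 c hc, fun s hs => by
      obtain ⟨F, hF, hsF⟩ := hchain.directedOn.exists_mem_subset_of_finite_of_subset_sUnion
        hne s.finite_toSet hs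
      exact (h𝒞 hF).2 s hsF⟩, fun F hF => Set.subset_sUnion_of_mem hF⟩) _ h₀
  obtain ⟨hFcl, hFfin⟩ := hFmax.prop
  have hmem : ∀ c : X × Submodule R X, IsClosed (c.2 : Set X) →
      (∀ s : Finset (X × Submodule R X), ↑s ⊆ F → ∃ y, y - c.1 ∈ c.2 ∧ ∀ d ∈ s, y - d.1 ∈ d.2) →
      c ∈ F := by
    intro c hc h
    refine hFmax.le_of_ge (y := insert c F) ⟨?_, ?_⟩ (Set.subset_insert _ _)
      (Set.mem_insert _ _)
    · rintro d (rfl | hd)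
      exacts [hc, hFcl d hd]
    · intro s hs
      obtain ⟨y, hyc, hy⟩ := h (s.erase c) (fun d hd => by
        have hd' : d ≠ c ∧ d ∈ s := Finset.mem_erase.1 hd
        exact (hs hd'.2).resolve_left hd'.1)
      refine ⟨y, fun d hd => ?_⟩
      by_cases hdc : d = c
      · rwa [hdc]
      · exact hy d (Finset.mem_erase.2 ⟨hdc, hd⟩)
  have hinter : ∀ s : Finset (X × Submodule R X), ↑s ⊆ F → ∀ y, (∀ c ∈ s, y - c.1 ∈ c.2) →
      ∃ K, (y, K) ∈ F ∧ ∀ c ∈ s, K ≤ c.2 := by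
    intro s hs y hy
    refine ⟨⨅ c ∈ s, c.2, hmem _ ?_ ?_, fun c hc => iInf₂_le c hc⟩
    · simp only [Submodule.coe_iInf]
      exact isClosed_iInter fun c => isClosed_iInter fun hc => hFcl c (hs hc)
    · intro t ht
      obtain ⟨z, hz⟩ := hFfin (s ∪ t) (by
        rw [Finset.coe_union]; exact Set.union_subset hs ht)
      refine ⟨z, ?_, fun d hd => hz d (Finset.mem_union_right _ hd)⟩
      simp only [Submodule.mem_iInf]
      intro c hc
      have := c.2.sub_mem (hz c (Finset.mem_union_left _ hc)) (hy c hc)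
      rwa [sub_sub_sub_cancel_right] at this
  have hopen : ∀ V : {V : Submodule R X // IsOpen (V : Set X)}, ∃ x, (x, V.1) ∈ F := by
    rintro ⟨V, hV⟩
    have := hart V hV
    have hFne : ((fun c : X × Submodule R X => c.2.map V.mkQ) '' F).Nonempty :=
      (hinter ∅ (by simp) 0 (by simp)).elim fun K hK => ⟨_, _, hK.1, rfl⟩
    obtain ⟨_, ⟨c, hc, rfl⟩, hmin⟩ :=
      (wellFounded_lt (α := Submodule R (X ⧸ V))).has_min _ hFne
    refine ⟨c.1, hmem _ (V.toAddSubgroup.isClosed_of_isOpen hV) fun s hs => ?_⟩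
    have hs' : ↑(insert c s) ⊆ F := by
      rw [Finset.coe_insert]; exact Set.insert_subset hc hs
    obtain ⟨y, hy⟩ := hFfin (insert c s) hs'
    obtain ⟨K, hK, hKle⟩ := hinter _ hs' y hy
    have heq : K.map V.mkQ = c.2.map V.mkQ :=
      eq_of_le_of_not_lt (Submodule.map_mono (hKle c (Finset.mem_insert_self _ _)))
        (hmin _ ⟨_, hK, rfl⟩)
    have hcy : V.mkQ (c.1 - y) ∈ K.map V.mkQ := by
      rw [heq]
      refine Submodule.mem_map_of_mem ?_
      rw [← neg_sub]
      exact c.2.neg_mem (hy c (Finset.mem_insert_self _ _))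
    obtain ⟨w, hw, hwy⟩ := hcy
    refine ⟨y + w, ?_, fun d hd => ?_⟩
    · have := (Submodule.Quotient.eq V).1 hwy
      rwa [show w - (c.1 - y) = y + w - c.1 by abel] at this
    · have hwd : w ∈ d.2 := hKle d (Finset.mem_insert_of_mem hd) hw
      rw [add_sub_right_comm]
      exact d.2.add_mem (hy d (Finset.mem_insert_of_mem hd)) hwd
  choose x hx using hopen
  obtain ⟨y, hy⟩ := hcomplete x (fun V W hVW => by
    obtain ⟨z, hz⟩ := hFfin {(x V, V.1), (x W, W.1)} (by
      simp [Set.insert_subset_iff, hx])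
    have h1 := hVW (hz (x V, V.1) (by simp))
    have h2 := hz (x W, W.1) (by simp)
    have := W.1.sub_mem h2 h1
    rwa [sub_sub_sub_cancel_left] at this)
  refine ⟨y, fun i => ?_⟩
  have hi : (x₀ i, W₀ i) ∈ F := hF₀ ⟨i, rfl⟩
  by_contra hyi
  have hnhds : (fun v => y - x₀ i + v) ⁻¹' (W₀ i : Set X)ᶜ ∈ nhds (0 : X) :=
    ((hW₀ i).isOpen_compl.preimage (continuous_const_add _)).mem_nhds (by simpa using hyi)
  obtain ⟨V, hV, hVW⟩ := hbasis.mem_iff.1 hnhds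
  obtain ⟨z, hz⟩ := hFfin {(x ⟨V, hV⟩, V), (x₀ i, W₀ i)} (by
    simp only [Finset.coe_insert, Finset.coe_singleton, Set.insert_subset_iff,
      Set.singleton_subset_iff]
    exact ⟨hx ⟨V, hV⟩, hi⟩)
  have h1 : z - y ∈ V := by
    have := V.sub_mem (hz (x ⟨V, hV⟩, V) (by simp)) (hy ⟨V, hV⟩)
    rwa [sub_sub_sub_cancel_right] at this
  refine hVW h1 ?_
  have h2 := hz (x₀ i, W₀ i) (by simp)
  rw [show z - (x₀ i, W₀ i).1 = y - x₀ i + (z - y) by abel] at h2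
  exact h2

lemma isClosed_of_isOpen_le [IsTopologicalAddGroup X] {V C : Submodule R X}
    (hV : IsOpen (V : Set X)) (hVC : V ≤ C) : IsClosed (C : Set X) :=
  C.toAddSubgroup.isClosed_of_isOpen (AddSubgroup.isOpen_mono (H₁ := V.toAddSubgroup) hVC hV)

/-- A linearly compact module is semisimple as a topological module if its quotients by open
submodules are semisimple and open submodules separate points. -/
theorem isSemisimpleTop_of_quotient [IsTopologicalAddGroup X] (hX : LinearlyCompact R X)
    (hsep : ∀ x : X, x ≠ 0 → ∃ V : Submodule R X, IsOpen (V : Set X) ∧ x ∉ V ∧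
      IsSemisimpleModule R (X ⧸ V)) : IsSemisimpleTop R X := by
  intro W hW
  let 𝒵 : Set (Submodule R X)ᵒᵈ := {W' | IsClosed (W'.ofDual : Set X) ∧ W ⊔ W'.ofDual = ⊤}
  have hbdd : ∀ 𝒞 ⊆ 𝒵, IsChain (· ≤ ·) 𝒞 → ∀ W₁ ∈ 𝒞, ∃ W₂ ∈ 𝒵, ∀ W' ∈ 𝒞, W' ≤ W₂ := by
    intro 𝒞 h𝒞 hchain W₁ hW₁
    refine ⟨OrderDual.toDual (⨅ W' : 𝒞, OrderDual.ofDual W'.1), ⟨?_, ?_⟩,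
      fun W' hW' => iInf_le (fun W' : 𝒞 => OrderDual.ofDual W'.1) ⟨W', hW'⟩⟩
    · rw [OrderDual.ofDual_toDual, Submodule.coe_iInf]
      exact isClosed_iInter fun W' => (h𝒞 W'.2).1
    rw [eq_top_iff]
    rintro x -
    have hdec : ∀ W' : 𝒞, ∃ w ∈ W, x - w ∈ OrderDual.ofDual W'.1 := fun W' => by
      obtain ⟨w, hw, w', hw', rfl⟩ :=
        Submodule.mem_sup.1 ((h𝒞 W'.2).2 ▸ Submodule.mem_top : x ∈ W ⊔ OrderDual.ofDual W'.1)
      exact ⟨w, hw, by rwa [add_sub_cancel_left]⟩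
    choose w hw hxw using hdec
    obtain ⟨y, hy⟩ := hX 𝒞 w (fun W' => W ⊓ OrderDual.ofDual W'.1)
      (fun W' => hW.inter (h𝒞 W'.2).1) (fun s => by
        have : Nonempty 𝒞 := ⟨⟨W₁, hW₁⟩⟩
        obtain ⟨W₂, hW₂⟩ := hchain.directed.finset_le s
        refine ⟨w W₂, fun W' hW' => ⟨W.sub_mem (hw _) (hw _), ?_⟩⟩
        have := Submodule.sub_mem _ (hxw W') (hW₂ W' hW' (hxw W₂))
        rwa [sub_sub_sub_cancel_left] at this)
    refine Submodule.mem_sup.2 ⟨y, ?_, x - y, ?_, add_sub_cancel _ _⟩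
    · have := W.add_mem (hy ⟨W₁, hW₁⟩).1 (hw ⟨W₁, hW₁⟩)
      rwa [sub_add_cancel] at this
    · refine (Submodule.mem_iInf _).2 fun W' => ?_
      have := Submodule.sub_mem _ (hxw W') (hy W').2
      rwa [sub_sub_sub_cancel_right] at this
  obtain ⟨W', -, hmin⟩ := zorn_le_nonempty₀ 𝒵 hbdd (OrderDual.toDual ⊤)
    ⟨isClosed_univ, sup_top_eq W⟩
  obtain ⟨hcl, htop⟩ := hmin.prop
  refine ⟨W'.ofDual, hcl, ?_, codisjoint_iff.2 htop⟩
  rw [disjoint_iff, Submodule.eq_bot_iff]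
  by_contra! hne
  obtain ⟨x, hx, hx0⟩ := hne
  obtain ⟨V, hV, hxV, hss⟩ := hsep x hx0
  obtain ⟨C, hVC, hCinf, hCsup⟩ := exists_complement_of_isSemisimpleModule_quotient V
    (W ⊓ W'.ofDual)
  have hCcl : IsClosed (C : Set X) := isClosed_of_isOpen_le hV hVC
  have hsup : W ⊓ W'.ofDual ⊔ C ⊓ W'.ofDual = W'.ofDual := by
    rw [← sup_inf_assoc_of_le C (inf_le_right : W ⊓ W'.ofDual ≤ W'.ofDual), hCsup, top_inf_eq]
  have hle : W'.ofDual ≤ C ⊓ W'.ofDual := hmin.le_of_ge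
    (y := OrderDual.toDual (C ⊓ W'.ofDual)) ⟨hCcl.inter hcl, by
      rw [eq_top_iff, ← htop, OrderDual.ofDual_toDual]
      conv_lhs => rw [← hsup, ← sup_assoc]
      exact sup_le_sup_right (sup_le le_rfl inf_le_left) _⟩
    (show C ⊓ W'.ofDual ≤ W'.ofDual from inf_le_right)
  exact hxV (hCinf ⟨(hle hx.2).1, hx⟩)

/-- Quotients of a semisimple topological module by open submodules are semisimple. -/
theorem IsSemisimpleTop.quotient [IsTopologicalAddGroup X] (hX : IsSemisimpleTop R X)
    {V : Submodule R X} (hV : IsOpen (V : Set X)) : IsSemisimpleModule R (X ⧸ V) := by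
  rw [isSemisimpleModule_iff]
  refine ⟨fun T => ?_⟩
  obtain ⟨W', -, hW'⟩ := hX _ (isClosed_of_isOpen_le hV (V.le_comap_mkQ T))
  refine ⟨W'.map V.mkQ, ?_, ?_⟩
  · rw [disjoint_iff, Submodule.eq_bot_iff]
    rintro _ ⟨ht, w, hw, rfl⟩
    have : w ∈ (⊥ : Submodule R X) := hW'.inf_eq_bot ▸ ⟨ht, hw⟩
    rw [(Submodule.mem_bot R).1 this, map_zero]
  · rw [codisjoint_iff, eq_top_iff]
    rintro z -
    obtain ⟨z, rfl⟩ := V.mkQ_surjective z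
    have : z ∈ T.comap V.mkQ ⊔ W' := hW'.sup_eq_top ▸ Submodule.mem_top
    obtain ⟨t, ht, w, hw, rfl⟩ := Submodule.mem_sup.1 this
    rw [map_add]
    exact Submodule.add_mem_sup ht (Submodule.mem_map_of_mem hw)

variable (R X) in
/-- The submodule of elements mapping into the socle of every discrete quotient. -/
def openSocle : Submodule R X :=
  ⨅ (V : Submodule R X) (_ : IsOpen (V : Set X)), (algSocle R (X ⧸ V)).comap V.mkQ

lemma mem_openSocle {x : X} : x ∈ openSocle R X ↔
    ∀ V : Submodule R X, IsOpen (V : Set X) → V.mkQ x ∈ algSocle R (X ⧸ V) := by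
  simp [openSocle]

lemma openSocle_le_comap {f : X →ₗ[R] Y} (hf : Continuous f) :
    openSocle R X ≤ (openSocle R Y).comap f := by
  intro x hx
  refine mem_openSocle.2 fun V hV => ?_
  rw [← mk_mem_algSocle_comap_iff]
  exact mem_openSocle.1 hx _ (hV.preimage hf)

/-- In a linearly compact module in which open submodules separate points, the largest closed
semisimple submodule consists of the elements mapping into the socle of every discrete
quotient. -/
theorem isGreatest_openSocle [IsTopologicalAddGroup X] (hX : LinearlyCompact R X)
    (hsep : ∀ x : X, x ≠ 0 → ∃ V : Submodule R X, IsOpen (V : Set X) ∧ x ∉ V) :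
    IsGreatest {W : Submodule R X | IsClosed (W : Set X) ∧ IsSemisimpleTop R W}
      (openSocle R X) := by
  have hcl : IsClosed (openSocle R X : Set X) := by
    simp only [openSocle, Submodule.coe_iInf]
    refine isClosed_iInter fun V => isClosed_iInter fun hV =>
      isClosed_of_isOpen_le hV (V.le_comap_mkQ _)
  refine ⟨⟨hcl, ?_⟩, ?_⟩
  · have : IsTopologicalAddGroup (openSocle R X) :=
      inferInstanceAs (IsTopologicalAddGroup (openSocle R X).toAddSubgroup)
    refine isSemisimpleTop_of_quotient (hX.submodule hcl) fun x hx => ?_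
    obtain ⟨V, hV, hxV⟩ := hsep x (fun h => hx (Subtype.ext h))
    refine ⟨V.comap (openSocle R X).subtype, hV.preimage continuous_subtype_val, hxV, ?_⟩
    have hss := isSemisimpleModule_algSocle (R := R) (X := X ⧸ V)
    let f := (V.comap (openSocle R X).subtype).mapQ V (openSocle R X).subtype le_rfl
    have hf : Function.Injective f := by
      rw [← LinearMap.ker_eq_bot, Submodule.ker_mapQ, Submodule.mkQ_map_self]
    refine IsSemisimpleModule.of_injective (f.codRestrict (algSocle R (X ⧸ V)) fun z => ?_)
      fun a b h => hf (congrArg Subtype.val h)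
    obtain ⟨z, rfl⟩ := Submodule.mkQ_surjective _ z
    exact mem_openSocle.1 z.2 V hV
  · rintro W ⟨-, hWss⟩
    have : IsTopologicalAddGroup W := inferInstanceAs (IsTopologicalAddGroup W.toAddSubgroup)
    intro w hw
    refine mem_openSocle.2 fun V hV => ?_
    have hq := hWss.quotient (V := V.comap W.subtype) (hV.preimage continuous_subtype_val)
    have hker : LinearMap.ker (V.mkQ ∘ₗ W.subtype) = V.comap W.subtype := by
      rw [LinearMap.ker_comp, Submodule.ker_mkQ]
    rw [← hker] at hq
    exact le_algSocle (IsSemisimpleModule.congr (V.mkQ ∘ₗ W.subtype).quotKerEquivRange.symm)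
      ⟨⟨w, hw⟩, rfl⟩

lemma socle_eq_of_isGreatest {S : Submodule R X}
    (hS : IsGreatest {W : Submodule R X | IsClosed (W : Set X) ∧ IsSemisimpleTop R W} S) :
    socle R X = S :=
  hS.isLUB.sSup_eq

end LinearlyCompact

section PseudocompactSocle

variable {k A X : Type} [Field k] [Ring A] [Algebra k A] [TopologicalSpace A] [AddCommGroup X]
  [Module k X] [Module A X] [IsScalarTower k A X] [TopologicalSpace X]

lemma IsPseudocompactMod.finiteDimensional_quotient (hX : IsPseudocompactMod k A X)
    {V : Submodule A X} (hV : IsOpen (V : Set X)) :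
    FiniteDimensional k (X ⧸ V.restrictScalars k) := by
  obtain ⟨V', ⟨-, hV'⟩, hle⟩ := hX.basis.mem_iff.1 (hV.mem_nhds V.zero_mem)
  exact Module.Finite.of_surjective
    (Submodule.mapQ (V'.restrictScalars k) (V.restrictScalars k) LinearMap.id fun _ h => hle h)
    fun z => by
      obtain ⟨z, rfl⟩ := Submodule.mkQ_surjective _ z
      exact ⟨Submodule.Quotient.mk z, rfl⟩

lemma IsPseudocompactMod.linearlyCompact (hX : IsPseudocompactMod k A X) :
    LinearlyCompact A X := by
  have := hX.addGroup
  refine linearlyCompact_of_complete (fun V hV => ?_) ?_ (fun x hx => ?_)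
  · have := hX.finiteDimensional_quotient hV
    have : FiniteDimensional k (X ⧸ V) :=
      Module.Finite.equiv (Submodule.Quotient.restrictScalarsEquiv k V)
    exact isArtinian_of_tower k inferInstance
  · exact hX.basis.congr (fun V => ⟨And.left, fun h => ⟨h, hX.finiteDimensional_quotient h⟩⟩)
      fun _ _ => rfl
  · obtain ⟨y, hy⟩ := hX.complete (fun V => V.1.mkQ (x ⟨V.1, V.2.1⟩)) (fun V W hVW => by
      have hle : V.1 ≤ W.1.comap LinearMap.id := hVW
      rw [mapQ', dif_pos hle]
      exact (Submodule.Quotient.eq W.1).2 (hx ⟨V.1, V.2.1⟩ ⟨W.1, W.2.1⟩ hVW))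
    exact ⟨y, fun V => (Submodule.Quotient.eq V.1).1
      (hy ⟨V.1, V.2, hX.finiteDimensional_quotient V.2⟩).symm⟩

lemma IsPseudocompactMod.exists_isOpen_of_isClosed (hX : IsPseudocompactMod k A X)
    {K : Submodule A X} (hK : IsClosed (K : Set X)) {x : X} (hx : x ∉ K) :
    ∃ V : Submodule A X, IsOpen (V : Set X) ∧ K ≤ V ∧ x ∉ V := by
  have := hX.addGroup
  have hnhds : (fun v => x - v) ⁻¹' (K : Set X)ᶜ ∈ nhds (0 : X) :=
    (hK.isOpen_compl.preimage (continuous_const.sub continuous_id)).mem_nhds (by simpa using hx)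
  obtain ⟨V, ⟨hV, -⟩, hVK⟩ := hX.basis.mem_iff.1 hnhds
  refine ⟨V ⊔ K, AddSubgroup.isOpen_mono (H₁ := V.toAddSubgroup)
    (H₂ := (V ⊔ K).toAddSubgroup) (fun v hv => (le_sup_left : V ≤ V ⊔ K) hv) hV,
    le_sup_right, fun h => ?_⟩
  obtain ⟨v, hv, w, hw, rfl⟩ := Submodule.mem_sup.1 h
  exact hVK hv (by simpa using hw)

/-- The largest closed semisimple submodule of a quotient of a pseudocompact module by a closed
submodule. -/
lemma IsPseudocompactMod.isGreatest_openSocle_quotient (hX : IsPseudocompactMod k A X)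
    {K : Submodule A X} (hK : IsClosed (K : Set X)) :
    IsGreatest {W : Submodule A (X ⧸ K) | IsClosed (W : Set (X ⧸ K)) ∧ IsSemisimpleTop A W}
      (openSocle A (X ⧸ K)) := by
  have := hX.addGroup
  refine isGreatest_openSocle
    (hX.linearlyCompact.of_surjective K.mkQ K.continuous_mkQ K.mkQ_surjective) fun x hx => ?_
  obtain ⟨x, rfl⟩ := K.mkQ_surjective x
  obtain ⟨V, hV, hKV, hxV⟩ := hX.exists_isOpen_of_isClosed hK
    (fun h => hx ((Submodule.Quotient.mk_eq_zero K).2 h))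
  refine ⟨V.map K.mkQ, K.isOpenMap_mkQ _ hV, fun h => hxV ?_⟩
  have h' : x ∈ (V.map K.mkQ).comap K.mkQ := h
  rwa [Submodule.comap_map_mkQ, sup_eq_right.2 hKV] at h'

lemma IsPseudocompactMod.isGreatest_openSocle (hX : IsPseudocompactMod k A X) :
    IsGreatest {W : Submodule A X | IsClosed (W : Set X) ∧ IsSemisimpleTop A W}
      (openSocle A X) := by
  have := hX.addGroup
  have := hX.t2
  refine ProfiniteBlocks.isGreatest_openSocle hX.linearlyCompact fun x hx => ?_
  obtain ⟨V, hV, -, hxV⟩ := hX.exists_isOpen_of_isClosed (K := ⊥)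
    (by rw [Submodule.bot_coe]; exact isClosed_singleton) (fun h => hx ((Submodule.mem_bot A).1 h))
  exact ⟨V, hV, hxV⟩

variable {G : Type} [Group G] [TopologicalSpace G]

lemma isClosed_coinvKer (N : OpenNormalSubgroup G) {U : Type} [AddCommGroup U]
    [Module (CGA k G) U] [TopologicalSpace U] : IsClosed (coinvKer k G N U : Set U) := by
  rw [coinvKer, Submodule.coe_sInf]
  exact isClosed_biInter fun W hW => hW.1

variable {U : Type} [AddCommGroup U] [Module k U] [Module (CGA k G) U]
  [IsScalarTower k (CGA k G) U] [TopologicalSpace U]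

lemma IsPseudocompactMod.socle_coinv_eq (hU : IsPseudocompactMod k (CGA k G) U)
    (N : OpenNormalSubgroup G) :
    socle (CGA k G) (coinv k G N U) = openSocle (CGA k G) (coinv k G N U) :=
  socle_eq_of_isGreatest (hU.isGreatest_openSocle_quotient (isClosed_coinvKer N))

variable [IsTopologicalGroup G]

lemma continuous_ofG : Continuous (ofG k G) := by
  refine Continuous.subtype_mk (continuous_pi fun N => ?_) _
  have : DiscreteTopology (G ⧸ N.toSubgroup) := QuotientGroup.discreteTopology N.isOpen'
  exact (continuous_of_discreteTopology
    (f := fun q : G ⧸ N.toSubgroup => (MonoidAlgebra.single q 1 :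
      MonoidAlgebra k (G ⧸ N.toSubgroup)))).comp continuous_quot_mk

/-- Every open submodule of a pseudocompact module contains the kernel of the projection onto
the `N`-coinvariants for some open normal subgroup `N`. -/
lemma IsPseudocompactMod.exists_coinvKer_le [CompactSpace G] [TotallyDisconnectedSpace G]
    (hU : IsPseudocompactMod k (CGA k G) U) {V : Submodule (CGA k G) U}
    (hV : IsOpen (V : Set U)) : ∃ N : OpenNormalSubgroup G, coinvKer k G N U ≤ V := by
  have := hU.addGroup
  have := hU.contSMul
  have := hU.finiteDimensional_quotient hV
  obtain ⟨s, hs⟩ := Module.Finite.fg_top (R := k) (M := U ⧸ V.restrictScalars k)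
  have hopen : IsOpen (⋂ b ∈ s, (fun g => ofG k G g • Quotient.out b - Quotient.out b) ⁻¹'
      (V : Set U)) :=
    isOpen_biInter_finset fun b _ =>
      hV.preimage ((continuous_ofG.smul continuous_const).sub continuous_const)
  obtain ⟨N, hN⟩ := ProfiniteGrp.exist_openNormalSubgroup_sub_open_nhds_of_one hopen
    (by simp)
  refine ⟨N, sInf_le ⟨V.toAddSubgroup.isClosed_of_isOpen hV, fun n hn u => ?_⟩⟩
  let T : Submodule k U :=
    { carrier := {u | ofG k G n • u - u ∈ V}
      add_mem' := fun {a b} ha hb => by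
        have := V.add_mem ha hb
        rwa [sub_add_sub_comm, ← smul_add] at this
      zero_mem' := by simp
      smul_mem' := fun c u hu => by
        have := (V.restrictScalars k).smul_mem c hu
        have hcomm : ofG k G n • c • u = c • ofG k G n • u := by
          rw [← algebraMap_smul (CGA k G) c u, ← algebraMap_smul (CGA k G) c (ofG k G n • u),
            smul_smul, smul_smul, Algebra.commutes]
        rw [smul_sub, ← hcomm] at this
        exact this }
  have hT : T.map (V.restrictScalars k).mkQ = ⊤ := by
    rw [eq_top_iff, ← hs, Submodule.span_le]
    intro b hb
    exact ⟨Quotient.out b, Set.mem_iInter₂.1 (hN hn) b hb, Quotient.out_eq b⟩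
  obtain ⟨t, ht, htu⟩ := (hT ▸ Submodule.mem_top :
    (V.restrictScalars k).mkQ u ∈ T.map (V.restrictScalars k).mkQ)
  have htu' : t - u ∈ V := (Submodule.Quotient.eq (V.restrictScalars k)).1 htu
  have := V.sub_mem ht (V.sub_mem (V.smul_mem (ofG k G n) htu') htu')
  rwa [smul_sub, show ofG k G n • t - t - (ofG k G n • t - ofG k G n • u - (t - u)) =
    ofG k G n • u - u by abel] at this

lemma IsPseudocompactMod.iInf_comap_socle_coinv [CompactSpace G] [TotallyDisconnectedSpace G]
    (hU : IsPseudocompactMod k (CGA k G) U) :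
    ⨅ N : OpenNormalSubgroup G, (socle (CGA k G) (coinv k G N U)).comap (phi k G N U) =
      openSocle (CGA k G) U := by
  have := hU.addGroup
  apply le_antisymm
  · intro x hx
    refine mem_openSocle.2 fun V hV => ?_
    obtain ⟨N, hN⟩ := hU.exists_coinvKer_le hV
    have hxN : phi k G N U x ∈ openSocle (CGA k G) (coinv k G N U) := by
      rw [← hU.socle_coinv_eq]
      exact (Submodule.mem_iInf _).1 hx N
    have hmem := mem_openSocle.1 hxN (V.map (phi k G N U))
      ((coinvKer k G N U).isOpenMap_mkQ _ hV)
    rw [← mk_mem_algSocle_comap_iff] at hmem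
    have hcomap : (V.map (phi k G N U)).comap (phi k G N U) = V := by
      rw [phi, Submodule.comap_map_mkQ, sup_eq_right.2 hN]
    rwa [hcomap] at hmem
  · refine le_iInf fun N => ?_
    rw [hU.socle_coinv_eq]
    exact openSocle_le_comap (coinvKer k G N U).continuous_mkQ

end PseudocompactSocle

/-- Lemma 2.12: For a pseudocompact `k⟦G⟧`-module `U`, the maps of
the inverse system `{U_N}` restrict to the socles, and the inverse limit of the
socles (taken inside `U = lim_N U_N`) is the maximal closed semisimple submodule
of `U`. -/
theorem socle_limit_is_greatest_closed_semisimple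
    (p : ℕ) [Fact p.Prime] (k : Type) [Field k] [CharP k p]
    (G : Type) [Group G] [TopologicalSpace G] [IsTopologicalGroup G]
    [CompactSpace G] [TotallyDisconnectedSpace G] [T2Space G]
    (U : Type) [AddCommGroup U] [Module k U] [Module (CGA k G) U]
    [IsScalarTower k (CGA k G) U] [TopologicalSpace U]
    (hU : IsPseudocompactMod k (CGA k G) U) :
    (∀ (N M : OpenNormalSubgroup G) (h : N ≤ M),
      (socle (CGA k G) (coinv k G N U)).map (phiT k G N M h U) ≤
        socle (CGA k G) (coinv k G M U)) ∧
    IsGreatest {W : Submodule (CGA k G) U |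
        IsClosed (W : Set U) ∧ IsSemisimpleTop (CGA k G) W}
      (⨅ N : OpenNormalSubgroup G,
        (socle (CGA k G) (coinv k G N U)).comap (phi k G N U)) := by
  refine ⟨fun N M h => ?_, ?_⟩
  · rw [hU.socle_coinv_eq, hU.socle_coinv_eq, Submodule.map_le_iff_le_comap]
    refine openSocle_le_comap ?_
    rw [(coinvKer k G N U).isQuotientMap_mkQ.continuous_iff]
    exact (coinvKer k G M U).continuous_mkQ
  · rw [hU.iInf_comap_socle_coinv]
    exact hU.isGreatest_openSocle

end ProfiniteBlocks
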